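/- Every eigenvalue (over the complex numbers) of an invertible totally nonnegative real n×n matrix is a positive real number. -/

import Mathlib

/-- A real square matrix is *totally nonnegative* if every minor (the determinant of
any square submatrix obtained by selecting equally many rows and columns, preserving
their order) is nonnegative. -/
def TotallyNonneg {n : ℕ} (A : Matrix (Fin n) (Fin n) ℝ) : Prop :=
  ∀ (k : ℕ) (r c : Fin k → Fin n), StrictMono r → StrictMono c →
    0 ≤ (A.submatrix r c).det

open Finset in
lemma cb_expand {k n : ℕ} (M : Matrix (Fin k) (Fin n) ℝ) (N : Matrix (Fin n) (Fin k) ℝ) :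
    (M * N).det = ∑ f : Fin k → Fin n, (M.submatrix id f).det * ∏ i, N (f i) i := by
  simp only [Matrix.det_apply', Matrix.mul_apply, prod_univ_sum, mul_sum, Fintype.piFinset_univ]
  rw [Finset.sum_comm]
  refine Finset.sum_congr rfl fun f _ => ?_
  rw [Finset.sum_mul]
  refine Finset.sum_congr rfl fun σ _ => ?_
  simp [prod_mul_distrib, mul_assoc]

open Finset in
lemma cb_sym {k n : ℕ} (M : Matrix (Fin k) (Fin n) ℝ) (N : Matrix (Fin n) (Fin k) ℝ) :
    (k.factorial : ℝ) * (M * N).det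
      = ∑ f : Fin k → Fin n, (M.submatrix id f).det * (N.submatrix f id).det := by
  have h : ∀ σ : Equiv.Perm (Fin k), (M * N).det
      = ∑ f : Fin k → Fin n, (M.submatrix id f).det *
          (((Equiv.Perm.sign σ : ℤ) : ℝ) * ∏ i, N (f (σ i)) i) := by
    intro σ
    rw [cb_expand]
    refine (Fintype.sum_equiv (Equiv.arrowCongr σ (Equiv.refl _)) _ _ fun f => ?_)
    have h1 : M.submatrix id (Equiv.arrowCongr σ (Equiv.refl _) f)
        = (M.submatrix id f).submatrix id (σ⁻¹ : Equiv.Perm (Fin k)) := by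
      ext i j; simp [Equiv.arrowCongr]
    rw [h1, Matrix.det_permute']
    simp [Equiv.arrowCongr]
    have h2 : (((Equiv.Perm.sign σ : ℤ) : ℝ)) * ((Equiv.Perm.sign σ : ℤ) : ℝ) = 1 := by
      rw [← Int.cast_mul, ← Units.val_mul]; simp
    linear_combination (-(M.submatrix id f).det * ∏ i, N (f i) i) * h2
  have h3 : (k.factorial : ℝ) * (M * N).det = ∑ σ : Equiv.Perm (Fin k), (M * N).det := by
    simp [Fintype.card_perm]
  rw [h3, Finset.sum_congr rfl fun σ _ => h σ, Finset.sum_comm]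
  refine Finset.sum_congr rfl fun f _ => ?_
  rw [← Finset.mul_sum, Matrix.det_apply' (N.submatrix f id)]
  rfl

lemma TotallyNonneg.mul {n : ℕ} {A B : Matrix (Fin n) (Fin n) ℝ} (hA : TotallyNonneg A)
    (hB : TotallyNonneg B) : TotallyNonneg (A * B) := by
  intro k r c hr hc
  have h1 : (A * B).submatrix r c = A.submatrix r id * B.submatrix id c := by
    ext i j; simp [Matrix.mul_apply]
  have h2 := cb_sym (A.submatrix r id) (B.submatrix id c)
  rw [h1]
  have h3 : 0 ≤ (k.factorial : ℝ) * (A.submatrix r id * B.submatrix id c).det := by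
    rw [h2]
    refine Finset.sum_nonneg fun f _ => ?_
    by_cases hf : Function.Injective f
    · set τ := Tuple.sort f
      have hm : StrictMono (f ∘ τ) :=
        (Tuple.monotone_sort f).strictMono_of_injective (hf.comp τ.injective)
      have e1 := hA k r _ hr hm
      have e2 := hB k _ c hm hc
      have e3 : A.submatrix r (f ∘ τ) = (A.submatrix r f).submatrix id τ := by ext; simp
      have e4 : B.submatrix (f ∘ τ) c = (B.submatrix f c).submatrix τ id := by ext; simp
      rw [e3, Matrix.det_permute'] at e1
      rw [e4, Matrix.det_permute] at e2
      have e5 : (((Equiv.Perm.sign τ : ℤ) : ℝ)) * ((Equiv.Perm.sign τ : ℤ) : ℝ) = 1 := by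
        rw [← Int.cast_mul, ← Units.val_mul]; simp
      have e6 := mul_nonneg e1 e2
      have e7 : (A.submatrix r f).det * (B.submatrix f c).det
        = (((Equiv.Perm.sign τ : ℤ) : ℝ) * (A.submatrix r f).det) *
          (((Equiv.Perm.sign τ : ℤ) : ℝ) * (B.submatrix f c).det) := by
        linear_combination (-(A.submatrix r f).det * (B.submatrix f c).det) * e5
      simpa [e7] using e6
    · rw [Function.not_injective_iff] at hf
      obtain ⟨a, b, hab, hne⟩ := hf
      rw [Matrix.det_zero_of_column_eq hne (by intro i; simp [hab])]
      simp
  exact nonneg_of_mul_nonneg_right h3 (by positivity)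

lemma TotallyNonneg.submatrix {n m : ℕ} {A : Matrix (Fin n) (Fin n) ℝ} (hA : TotallyNonneg A)
    (f g : Fin m → Fin n) (hf : StrictMono f) (hg : StrictMono g) :
    TotallyNonneg (A.submatrix f g) := by
  intro k r c hr hc
  rw [Matrix.submatrix_submatrix]
  exact hA k _ _ (hf.comp hr) (hg.comp hc)

lemma TotallyNonneg.pow {n : ℕ} {A : Matrix (Fin n) (Fin n) ℝ} (hA : TotallyNonneg A)
    (m : ℕ) : TotallyNonneg (A ^ (m + 1)) := by
  induction m with
  | zero => simpa using hA
  | succ m ih => rw [pow_succ]; exact ih.mul hA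

lemma TotallyNonneg.det_pos {n : ℕ} {A : Matrix (Fin n) (Fin n) ℝ} (hA : TotallyNonneg A)
    (hu : A.det ≠ 0) : 0 < A.det :=
  lt_of_le_of_ne (by simpa using hA n id id strictMono_id strictMono_id) hu.symm

lemma TotallyNonneg.entry {n : ℕ} {A : Matrix (Fin n) (Fin n) ℝ} (hA : TotallyNonneg A)
    (i j : Fin n) : 0 ≤ A i j := by
  simpa using hA 1 (fun _ => i) (fun _ => j) (Subsingleton.strictMono _) (Subsingleton.strictMono _)

lemma TotallyNonneg.corner {n : ℕ} {A : Matrix (Fin (n+1)) (Fin (n+1)) ℝ} (hA : TotallyNonneg A)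
    (hu : A.det ≠ 0) : 0 < A 0 0 := by
  refine lt_of_le_of_ne (hA.entry 0 0) fun h0 => hu ?_
  by_cases hrow : ∀ j, A 0 j = 0
  · exact Matrix.det_eq_zero_of_row_eq_zero 0 hrow
  · push Not at hrow
    obtain ⟨j, hj⟩ := hrow
    have hj0 : 0 < j := Fin.pos_iff_ne_zero.2 (by rintro rfl; exact hj h0.symm)
    refine Matrix.det_eq_zero_of_column_eq_zero 0 fun i => ?_
    rcases Fin.eq_zero_or_eq_succ i with rfl | ⟨i, rfl⟩
    · exact h0.symm
    have hs : ∀ a : Fin (n+1), 0 < a → StrictMono ![0, a] := by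
      intro a ha
      rw [Fin.strictMono_iff_lt_succ]
      intro i; fin_cases i; simpa using ha
    have := hA 2 ![0, i.succ] ![0, j] (hs _ (Fin.succ_pos i)) (hs _ hj0)
    rw [Matrix.det_fin_two] at this
    simp [← h0] at this
    have h1 := hA.entry 0 j
    have h2 := hA.entry i.succ 0
    have h3 : 0 < A 0 j := lt_of_le_of_ne h1 (Ne.symm hj)
    nlinarith

lemma det_schur {n : ℕ} (M : Matrix (Fin (n+1)) (Fin (n+1)) ℝ) (h : M 0 0 ≠ 0) :
    M.det = M 0 0 * (Matrix.of fun i j : Fin n =>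
      M i.succ j.succ - M i.succ 0 / M 0 0 * M 0 j.succ).det := by
  let B : Matrix (Fin (n+1)) (Fin (n+1)) ℝ := fun i j =>
    if i = 0 then M 0 j else M i j - M i 0 / M 0 0 * M 0 j
  have h1 : M.det = B.det := by
    refine Matrix.det_eq_of_forall_row_eq_smul_add_const
      (fun i => if i = 0 then 0 else M i 0 / M 0 0) 0 (by simp) ?_
    intro i j
    by_cases hi : i = 0
    · simp [B, hi]
    · simp [B, hi]
  rw [h1, Matrix.det_succ_column_zero, Fin.sum_univ_succ]
  rw [Finset.sum_eq_zero]
  · simp [B]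
    left
    congr 1
  · intro i _
    have : B i.succ 0 = 0 := by simp [B]; field_simp; simp
    simp [this]

lemma TotallyNonneg.leading {n : ℕ} {A : Matrix (Fin (n+1)) (Fin (n+1)) ℝ}
    (hA : TotallyNonneg A) (hu : A.det ≠ 0) :
    0 < (A.submatrix Fin.castSucc Fin.castSucc).det := by
  induction n with
  | zero => simp
  | succ n ih =>
    have h00 := hA.corner hu
    let S : Matrix (Fin (n+1)) (Fin (n+1)) ℝ := Matrix.of fun i j =>
      A i.succ j.succ - A i.succ 0 / A 0 0 * A 0 j.succ
    have hS : TotallyNonneg S := by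
      intro k r c hr hc
      have hcons : ∀ f : Fin k → Fin (n+1), StrictMono f →
          StrictMono (Fin.cons 0 (Fin.succ ∘ f) : Fin (k+1) → Fin (n+2)) := by
        intro f hf i j hij
        induction i using Fin.cases with
        | zero =>
          induction j using Fin.cases with
          | zero => simp at hij
          | succ j => simp
        | succ i =>
          induction j using Fin.cases with
          | zero => simp at hij
          | succ j => simpa using hf (by simpa using hij)
      have := hA (k+1) _ _ (hcons r hr) (hcons c hc)
      rw [det_schur _ (by simpa using h00.ne')] at this
      have hSe : S.submatrix r c = Matrix.of fun i j =>
          A (r i).succ (c j).succ - A (r i).succ 0 / A 0 0 * A 0 (c j).succ := rfl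
      rw [hSe]
      exact nonneg_of_mul_nonneg_right (by simpa using this) h00
    have hSd : S.det ≠ 0 := by
      intro h
      apply hu
      rw [det_schur A h00.ne']
      change _ * S.det = 0
      rw [h, mul_zero]
    have := ih hS hSd
    rw [det_schur _ (by simpa using h00.ne')]
    exact mul_pos (by simpa using h00) this

lemma TotallyNonneg.coeff_nonneg {n : ℕ} {A : Matrix (Fin n) (Fin n) ℝ} (hA : TotallyNonneg A)
    (k : ℕ) (hk : k ≤ n) : 0 ≤ (-1) ^ (n - k) * A.charpoly.coeff k := by
  have h := Matrix.charpoly_coeff_eq_sum_minors A (n - k) (by simp)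
  rw [Fintype.card_fin, Nat.sub_sub_self hk] at h
  rw [h, ← mul_assoc, ← mul_pow]
  simp only [mul_neg, mul_one, neg_neg, one_pow, one_mul]
  refine Finset.sum_nonneg fun s hs => ?_
  let e := s.orderIsoOfFin rfl
  rw [← Matrix.det_submatrix_equiv_self e.toEquiv, Matrix.submatrix_submatrix]
  refine hA _ _ _ ?_ ?_ <;>
  · intro i j hij
    simpa using hij

/-- A polynomial with nonnegative coefficients has no root in a sector around `[0,∞)`. -/
lemma sector {n : ℕ} (c : ℕ → ℝ) (hc : ∀ k ≤ n, 0 ≤ c k) (hn : 0 < c n) (ρ φ : ℝ) (hρ : 0 < ρ)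
    (hφ : |φ| < Real.pi / n) :
    ∑ k ∈ Finset.range (n + 1), (c k : ℂ) * (ρ * Complex.exp (φ * Complex.I)) ^ k ≠ 0 := by
  intro h
  have hn0 : 0 < (n : ℝ) := by
    rcases Nat.eq_zero_or_pos n with rfl | h
    · simp at hφ; exact absurd hφ (not_lt.2 (abs_nonneg _))
    · exact_mod_cast h
  have h1 : Complex.exp (((-(n / 2) * φ : ℝ) : ℂ) * Complex.I) *
      ∑ k ∈ Finset.range (n + 1), (c k : ℂ) * (ρ * Complex.exp (φ * Complex.I)) ^ k = 0 := by
    rw [h, mul_zero]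
  rw [Finset.mul_sum] at h1
  have h2 : ∀ k, Complex.exp (((-(n / 2) * φ : ℝ) : ℂ) * Complex.I) *
      ((c k : ℂ) * (ρ * Complex.exp (φ * Complex.I)) ^ k)
      = ((c k * ρ ^ k : ℝ) : ℂ) * Complex.exp ((((k - n / 2) * φ : ℝ) : ℂ) * Complex.I) := by
    intro k
    rw [mul_pow, ← Complex.exp_nat_mul]
    have : Complex.exp ((((k - n / 2) * φ : ℝ) : ℂ) * Complex.I)
      = Complex.exp (((-(n / 2) * φ : ℝ) : ℂ) * Complex.I) * Complex.exp (k * (φ * Complex.I)) := by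
      rw [← Complex.exp_add]; congr 1; push_cast; ring
    rw [this]; push_cast; ring
  simp only [h2] at h1
  have h3 := congrArg Complex.re h1
  simp only [Complex.re_sum, Complex.re_ofReal_mul, Complex.exp_ofReal_mul_I_re,
    Complex.zero_re] at h3
  have hcos : ∀ k ≤ n, 0 < Real.cos ((k - n / 2) * φ) := by
    intro k hk
    have hk' : (k : ℝ) ≤ n := by exact_mod_cast hk
    have hk0 : (0 : ℝ) ≤ k := by positivity
    have : |((k : ℝ) - n / 2) * φ| < Real.pi / 2 := by
      rw [abs_mul]
      have a1 : |(k : ℝ) - n / 2| ≤ n / 2 := by rw [abs_le]; constructor <;> linarith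
      calc _ ≤ (n : ℝ) / 2 * |φ| := by gcongr
        _ < n / 2 * (Real.pi / n) := by gcongr
        _ = Real.pi / 2 := by field_simp
    exact Real.cos_pos_of_mem_Ioo (abs_lt.1 this)
  have h4 : 0 < ∑ k ∈ Finset.range (n + 1), c k * ρ ^ k * Real.cos ((k - n / 2) * φ) := by
    refine Finset.sum_pos' (fun k hk => ?_) ⟨n, by simp, ?_⟩
    · have hk : k ≤ n := Nat.lt_succ_iff.1 (Finset.mem_range.1 hk)
      exact mul_nonneg (mul_nonneg (hc k hk) (by positivity)) (hcos k hk).le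
    · exact mul_pos (mul_pos hn (by positivity)) (hcos n le_rfl)
  linarith

lemma TotallyNonneg.no_root {n : ℕ} {A : Matrix (Fin n) (Fin n) ℝ} (hA : TotallyNonneg A)
    (ρ φ : ℝ) (hρ : 0 < ρ) (hφ : |φ| < Real.pi / n) :
    ¬ (Matrix.charpoly (A.map (algebraMap ℝ ℂ))).IsRoot (-(ρ * Complex.exp (φ * Complex.I))) := by
  intro h
  set w := (ρ * Complex.exp (φ * Complex.I)) with hw
  rw [Matrix.charpoly_map, Polynomial.IsRoot.def, Polynomial.eval_map,
    Polynomial.eval₂_eq_sum_range, Matrix.charpoly_natDegree_eq_dim, Fintype.card_fin] at h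
  refine sector (n := n) (fun k => (-1) ^ (n - k) * A.charpoly.coeff k)
    (fun k hk => hA.coeff_nonneg k hk) ?_ ρ φ hρ hφ ?_
  · have : A.charpoly.coeff n = 1 := by
      have := A.charpoly_monic.coeff_natDegree
      rwa [Matrix.charpoly_natDegree_eq_dim, Fintype.card_fin] at this
    simp [this]
  · rw [← hw]
    have : ∀ k ∈ Finset.range (n + 1), (((-1) ^ (n - k) * A.charpoly.coeff k : ℝ) : ℂ) * w ^ k
        = (-1) ^ n * (algebraMap ℝ ℂ (A.charpoly.coeff k) * (-w) ^ k) := by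
      intro k hk
      have hk : k ≤ n := Nat.lt_succ_iff.1 (Finset.mem_range.1 hk)
      obtain ⟨m, rfl⟩ := Nat.exists_eq_add_of_le hk
      have e : ((-1 : ℂ)) ^ k * (-1) ^ k = 1 := by rw [← mul_pow]; simp
      rw [neg_pow w, pow_add]
      simp only [Nat.add_sub_cancel_left, Complex.coe_algebraMap]
      push_cast
      linear_combination (-(-1) ^ m * (A.charpoly.coeff k : ℂ) * w ^ k) * e
    rw [Finset.sum_congr rfl this, ← Finset.mul_sum, h, mul_zero]

lemma TotallyNonneg.arg_eq_zero {n : ℕ} {A : Matrix (Fin n) (Fin n) ℝ} (hA : TotallyNonneg A)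
    (z : ℂ) (hz0 : z ≠ 0) (hz : (Matrix.charpoly (A.map (algebraMap ℝ ℂ))).IsRoot z)
    (harg : |z.arg| < Real.pi / n) : z.arg = 0 := by
  by_contra h0
  have hθ : 0 < |z.arg| := abs_pos.2 h0
  set m := ⌊Real.pi / |z.arg|⌋₊ with hm
  have h1 : (m : ℝ) * |z.arg| ≤ Real.pi := by
    rw [← le_div_iff₀ hθ]; exact Nat.floor_le (by positivity)
  have h2 : Real.pi < (m + 1) * |z.arg| := by
    rw [← div_lt_iff₀ hθ]; exact Nat.lt_floor_add_one _
  have hm1 : m ≠ 0 := by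
    have : 1 ≤ m := by
      rw [hm]; apply Nat.le_floor; rw [le_div_iff₀ hθ]; simpa using Complex.abs_arg_le_pi z
    omega
  obtain ⟨l, hl⟩ := Nat.exists_eq_succ_of_ne_zero hm1
  have hB := hA.pow l
  rw [← Nat.succ_eq_add_one, ← hl] at hB
  have hroot : (Matrix.charpoly ((A ^ m).map (algebraMap ℝ ℂ))).IsRoot (z ^ m) := by
    rw [← Matrix.mem_spectrum_iff_isRoot_charpoly] at hz ⊢
    have : (A ^ m).map (algebraMap ℝ ℂ) = (A.map (algebraMap ℝ ℂ)) ^ m := 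
      Matrix.map_pow A (algebraMap ℝ ℂ) m
    rw [this]
    exact spectrum.pow_mem_pow _ m hz
  have key : ∃ φ : ℝ, |φ| < Real.pi / n ∧
      z ^ m = -(((‖z‖ ^ m : ℝ) : ℂ) * Complex.exp (φ * Complex.I)) := by
    have hzm : z ^ m = ((‖z‖ ^ m : ℝ) : ℂ) * Complex.exp ((m * z.arg : ℝ) * Complex.I) := by
      conv_lhs => rw [← Complex.norm_mul_exp_arg_mul_I z]
      rw [mul_pow, ← Complex.exp_nat_mul]
      push_cast
      congr 2; ring
    rcases lt_or_gt_of_ne h0 with hneg | hpos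
    · rw [abs_of_neg hneg] at *
      refine ⟨m * z.arg + Real.pi, ?_, ?_⟩
      · rw [abs_lt]; constructor <;> nlinarith
      · rw [hzm]; push_cast; rw [add_mul, Complex.exp_add, Complex.exp_pi_mul_I]; ring
    · rw [abs_of_pos hpos] at *
      refine ⟨m * z.arg - Real.pi, ?_, ?_⟩
      · rw [abs_lt]; constructor <;> nlinarith
      · rw [hzm]; push_cast; rw [sub_mul, Complex.exp_sub, Complex.exp_pi_mul_I]; ring
  obtain ⟨φ, hφ, he⟩ := key
  rw [he] at hroot
  exact hB.no_root _ φ (by have := norm_pos_iff.2 hz0; positivity) hφ hroot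

lemma gap (n : ℕ) (hn : n ≠ 0) : ∃ κ : ℝ, κ < 1 ∧ ∀ A : Matrix (Fin n) (Fin n) ℝ, TotallyNonneg A →
    A.det ≠ 0 → ∀ z, (Matrix.charpoly (A.map (algebraMap ℝ ℂ))).IsRoot z →
    z.re ≤ κ * ‖z‖ ∨ ∃ r : ℝ, 0 < r ∧ z = r := by
  have hn' : (1 : ℝ) ≤ n := by exact_mod_cast Nat.one_le_iff_ne_zero.2 hn
  have hpi := Real.pi_pos
  have hle : Real.pi / n ≤ Real.pi := div_le_self hpi.le hn'
  have hpos : 0 < Real.pi / n := by positivity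
  refine ⟨Real.cos (Real.pi / n), ?_, ?_⟩
  · rw [← Real.cos_zero]
    exact Real.cos_lt_cos_of_nonneg_of_le_pi le_rfl hle hpos
  · intro A hA hdet z hz
    by_cases hz0 : z = 0
    · left; simp [hz0]
    by_cases harg : |z.arg| < Real.pi / n
    · right
      have h0 := hA.arg_eq_zero z hz0 hz harg
      refine ⟨‖z‖, norm_pos_iff.2 hz0, ?_⟩
      have := Complex.norm_mul_exp_arg_mul_I z
      rw [h0] at this
      simpa using this.symm
    · left
      have h1 : Real.cos z.arg ≤ Real.cos (Real.pi / n) := by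
        rw [← Real.cos_abs z.arg]
        exact Real.cos_le_cos_of_nonneg_of_le_pi hpos.le (Complex.abs_arg_le_pi z) (not_lt.1 harg)
      have h2 := Complex.norm_mul_cos_arg z
      rw [← h2, mul_comm]
      gcongr

open Polynomial Filter Topology in
lemma poly_deform (p q : ℂ[X]) (N : ℕ) (κ : ℝ) (hκ : κ < 1) (F : ℝ → ℂ[X])
    (hF : ∀ t : ℝ, F t = C ((1 - t : ℝ) : ℂ) * (X * q) + C (t : ℂ) * p)
    (hmon : ∀ t : ℝ, 0 < t → t ≤ 1 → (F t).Monic ∧ (F t).natDegree = N)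
    (hgap : ∀ t : ℝ, 0 < t → t ≤ 1 → ∀ z, (F t).IsRoot z →
      z.re ≤ κ * ‖z‖ ∨ ∃ r : ℝ, 0 < r ∧ z = r)
    (hq : ∀ z, q.IsRoot z → ∃ r : ℝ, 0 < r ∧ z = r)
    (c : ℝ) (hc : 0 < c) (hq0 : q.eval 0 ≠ 0) (hpq : p.eval 0 = -(c * q.eval 0)) :
    ∀ z, p.IsRoot z → ∃ r : ℝ, 0 < r ∧ z = r := by
  have hZpos : ∀ r : ℝ, 0 < r → ¬ ((r : ℂ).re ≤ κ * ‖(r : ℂ)‖) := by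
    intro r hr
    rw [Complex.norm_real, Complex.ofReal_re, Real.norm_of_nonneg hr.le]
    nlinarith
  have hp0 : p.eval 0 ≠ 0 := by
    rw [hpq]; exact neg_ne_zero.2 (mul_ne_zero (by exact_mod_cast hc.ne') hq0)
  have hev : ∀ (t : ℝ) z, (F t).eval z = ((1 - t : ℝ) : ℂ) * (z * q.eval z) + t * p.eval z := by
    intro t z; rw [hF]; simp
  have hcont : Continuous fun x : ℝ × ℂ => (F x.1).eval x.2 := by
    simp only [hev]
    have h1 := q.continuous
    have h2 := p.continuous
    fun_prop
  intro z1 hz1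
  by_contra hbad
  let T : Set ℝ := {t | 0 < t ∧ t ≤ 1 ∧ ∃ z, (F t).IsRoot z ∧ z.re ≤ κ * ‖z‖}
  have hF1 : F 1 = p := by rw [hF]; simp
  have h1T : (1 : ℝ) ∈ T := by
    refine ⟨one_pos, le_rfl, z1, by rwa [hF1], ?_⟩
    exact (hgap 1 one_pos le_rfl z1 (by rwa [hF1])).resolve_right hbad
  have hbdd : BddBelow T := ⟨0, fun t ht => ht.1.le⟩
  obtain ⟨u, -, hu, huT⟩ := exists_seq_tendsto_sInf ⟨1, h1T⟩ hbdd
  set t0 := sInf T with ht0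
  have ht0nn : 0 ≤ t0 := le_csInf ⟨1, h1T⟩ fun t ht => ht.1.le
  have ht01 : t0 ≤ 1 := csInf_le hbdd h1T
  choose hu0 hu1 zs hzr hzZ using huT
  -- the roots are bounded
  have hR : ∃ R : ℝ, ∀ k, zs k ∈ Metric.closedBall (0 : ℂ) R := by
    refine ⟨(((Finset.range N).sup fun i => ‖(X * q).coeff i‖₊ + ‖p.coeff i‖₊) + 1 : NNReal),
      fun k => ?_⟩
    obtain ⟨hm, hd⟩ := hmon (u k) (hu0 k) (hu1 k)
    have h1 := (hzr k).norm_lt_cauchyBound hm.ne_zero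
    rw [mem_closedBall_zero_iff]
    have h2 : (F (u k)).cauchyBound ≤
        ((Finset.range N).sup fun i => ‖(X * q).coeff i‖₊ + ‖p.coeff i‖₊) + 1 := by
      rw [cauchyBound, hm.leadingCoeff, hd]
      simp only [nnnorm_one, div_one]
      gcongr with i hi
      rw [hF, coeff_add, coeff_C_mul, coeff_C_mul]
      have a0 := hu0 k
      have a1 := hu1 k
      refine (nnnorm_add_le _ _).trans ?_
      rw [nnnorm_mul, nnnorm_mul]
      have b1 : ‖((1 - u k : ℝ) : ℂ)‖₊ ≤ 1 := by
        rw [← NNReal.coe_le_coe, coe_nnnorm, Complex.norm_real, Real.norm_eq_abs, abs_le]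
        constructor <;> simp <;> linarith
      have b2 : ‖(u k : ℂ)‖₊ ≤ 1 := by
        rw [← NNReal.coe_le_coe, coe_nnnorm, Complex.norm_real, Real.norm_eq_abs, abs_le]
        constructor <;> simp <;> linarith
      exact add_le_add (mul_le_of_le_one_left' b1) (mul_le_of_le_one_left' b2)
    refine le_trans ?_ (NNReal.coe_le_coe.2 h2)
    exact_mod_cast h1.le
  obtain ⟨R, hR⟩ := hR
  obtain ⟨z, -, φ, hφ, hz⟩ := tendsto_subseq_of_bounded Metric.isBounded_closedBall hR
  have huφ : Tendsto (u ∘ φ) atTop (𝓝 t0) := hu.comp hφ.tendsto_atTop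
  have hroot : (F t0).eval z = 0 := by
    have h1 : Tendsto (fun k => (F (u (φ k))).eval (zs (φ k))) atTop (𝓝 ((F t0).eval z)) :=
      (hcont.tendsto (t0, z)).comp (huφ.prodMk_nhds hz)
    have h2 : (fun k => (F (u (φ k))).eval (zs (φ k))) = fun _ => 0 := by
      funext k; exact hzr (φ k)
    rw [h2] at h1
    exact tendsto_nhds_unique h1 tendsto_const_nhds |>.symm ▸ rfl
  have hZcl : IsClosed {z : ℂ | z.re ≤ κ * ‖z‖} :=
    isClosed_le Complex.continuous_re (by fun_prop)
  have hzZ' : z.re ≤ κ * ‖z‖ :=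
    hZcl.mem_of_tendsto hz (Eventually.of_forall fun k => hzZ (φ k))
  rcases ht0nn.lt_or_eq with hpos | hzero
  · -- positive infimum
    have hz0 : z ≠ 0 := by
      rintro rfl
      rw [hev] at hroot
      simp [hp0, hpos.ne'] at hroot
    have hznot : z ∉ (fun r : ℝ => (r : ℂ)) '' Set.Ici 0 := by
      rintro ⟨r, hr, rfl⟩
      have hr0 : r ≠ 0 := by rintro rfl; simp at hz0
      exact hZpos r (lt_of_le_of_ne hr hr0.symm) hzZ'
    have hcl : IsClosed ((fun r : ℝ => (r : ℂ)) '' Set.Ici 0) :=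
      Complex.isometry_ofReal.isClosedEmbedding.isClosedMap _ isClosed_Ici
    have hd : 0 < Metric.infDist z ((fun r : ℝ => (r : ℂ)) '' Set.Ici 0) :=
      (hcl.notMem_iff_infDist_pos ⟨0, 0, by simp, by simp⟩).1 hznot
    set d := Metric.infDist z ((fun r : ℝ => (r : ℂ)) '' Set.Ici 0) with hdd
    have hlow : ∀ t, 0 < t → t < t0 → d ^ N ≤ ‖(F t).eval z‖ := by
      intro t h0 h1
      have htT : t ∉ T := notMem_of_lt_csInf h1 hbdd
      obtain ⟨hm, hdeg⟩ := hmon t h0 (h1.le.trans ht01)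
      have hs := IsAlgClosed.splits (F t)
      rw [hs.eval_eq_prod_roots_of_monic hm, ← hdeg, hs.natDegree_eq_card_roots]
      have hall : ∀ w ∈ (F t).roots, d ≤ ‖z - w‖ := by
        intro w hw
        have hw : (F t).IsRoot w := isRoot_of_mem_roots hw
        rcases hgap t h0 (h1.le.trans ht01) w hw with h | ⟨r, hr, rfl⟩
        · exact absurd ⟨h0, h1.le.trans ht01, w, hw, h⟩ htT
        · rw [← dist_eq_norm]
          exact Metric.infDist_le_dist_of_mem ⟨r, hr.le, rfl⟩
      generalize (F t).roots = s at hall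
      induction s using Multiset.induction_on with
      | empty => simp
      | cons a s ih =>
        simp only [Multiset.map_cons, Multiset.prod_cons, Multiset.card_cons, norm_mul, pow_succ']
        have := ih fun w hw => hall w (Multiset.mem_cons_of_mem hw)
        have h2 := hall a (Multiset.mem_cons_self a s)
        gcongr
    have hlim : Tendsto (fun t => ‖(F t).eval z‖) (𝓝[<] t0) (𝓝 ‖(F t0).eval z‖) := by
      have : Continuous fun t : ℝ => ‖(F t).eval z‖ :=
        (hcont.comp (Continuous.prodMk_left z)).norm
      exact (this.tendsto t0).mono_left nhdsWithin_le_nhds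
    have := ge_of_tendsto hlim (b := d ^ N) (by
      filter_upwards [Ioo_mem_nhdsLT hpos] with t ht
      exact hlow t ht.1 ht.2)
    rw [hroot, norm_zero] at this
    exact absurd this (not_le.2 (by positivity))
  · rw [← hzero] at hroot huφ
    rw [hev] at hroot
    simp at hroot
    rcases hroot with rfl | hqz
    · have hqlim : Tendsto (fun k => q.eval (zs (φ k))) atTop (𝓝 (q.eval 0)) :=
        (q.continuous.tendsto 0).comp hz
      have hplim : Tendsto (fun k => p.eval (zs (φ k))) atTop (𝓝 (p.eval 0)) :=
        (p.continuous.tendsto 0).comp hz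
      have hlim : Tendsto (fun k => -(p.eval (zs (φ k)) / q.eval (zs (φ k)))) atTop (𝓝 (c : ℂ)) := by
        have := (hplim.div hqlim hq0).neg
        rwa [hpq, neg_div, neg_neg, mul_div_assoc, div_self hq0, mul_one] at this
      refine hZpos c hc (hZcl.mem_of_tendsto hlim ?_)
      filter_upwards [hqlim.eventually_ne hq0] with k hk
      have a0 := hu0 (φ k)
      have a1 := hu1 (φ k)
      have hr := hzr (φ k)
      have hZk := hzZ (φ k)
      rw [IsRoot.def, hev] at hr
      have he : -(p.eval (zs (φ k)) / q.eval (zs (φ k)))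
          = (((1 - u (φ k)) / u (φ k) : ℝ) : ℂ) * zs (φ k) := by
        have hne : (u (φ k) : ℂ) ≠ 0 := by exact_mod_cast a0.ne'
        push_cast
        push_cast at hr
        field_simp
        linear_combination -hr
      rw [he, Complex.re_ofReal_mul, norm_mul, Complex.norm_real,
        Real.norm_of_nonneg (div_nonneg (by linarith) a0.le)]
      have : 0 ≤ (1 - u (φ k)) / u (φ k) := div_nonneg (by linarith) a0.le
      nlinarith [mul_le_mul_of_nonneg_left hZk this]
    · obtain ⟨r, hr, rfl⟩ := hq z hqz
      exact hZpos r hr hzZ'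

open Polynomial in
lemma charpoly_scale {n : ℕ} {R : Type*} [CommRing R] (A : Matrix (Fin (n+1)) (Fin (n+1)) R) (t : R) :
    (Matrix.of fun i j => (if j = Fin.last n then t else 1) * A i j).charpoly
      = C (1 - t) * (X * (A.submatrix Fin.castSucc Fin.castSucc).charpoly) + C t * A.charpoly := by
  classical
  set M := A.charmatrix
  have h1 : (Matrix.of fun i j => (if j = Fin.last n then t else 1) * A i j).charmatrix
      = M.updateCol (Fin.last n) (C (1 - t) • (fun i => if i = Fin.last n then X else 0)
        + C t • (fun i => M i (Fin.last n))) := by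
    ext1 i j
    by_cases hj : j = Fin.last n
    · subst hj
      by_cases hi : i = Fin.last n
      · subst hi
        simp [M, Matrix.charmatrix_apply]
        ring
      · simp [M, Matrix.charmatrix_apply, hi]
    · simp [M, Matrix.charmatrix_apply, hj]
  have h2 : (M.updateCol (Fin.last n) (fun i => if i = Fin.last n then X else 0)).det
      = X * (A.submatrix Fin.castSucc Fin.castSucc).charpoly := by
    rw [Matrix.det_succ_column _ (Fin.last n), Fin.sum_univ_castSucc, Finset.sum_eq_zero]
    · simp only [zero_add, Matrix.updateCol_self, if_true, Matrix.charpoly]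
      rw [Matrix.submatrix_updateCol_succAbove]
      have h3 : M.submatrix (Fin.last n).succAbove (Fin.last n).succAbove
          = (A.submatrix Fin.castSucc Fin.castSucc).charmatrix := by
        ext1 i j
        simp [M, Matrix.charmatrix_apply, Matrix.diagonal_apply]
      rw [h3, ← two_mul, pow_mul]
      simp
    · intro i _
      simp [(Fin.castSucc_lt_last i).ne]
  rw [Matrix.charpoly, h1, Matrix.det_updateCol_add, Matrix.det_updateCol_smul,
    Matrix.det_updateCol_smul, h2, Matrix.updateCol_eq_self]
  rfl

lemma TotallyNonneg.scale {n : ℕ} {A : Matrix (Fin n) (Fin n) ℝ} (hA : TotallyNonneg A)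
    (v : Fin n → ℝ) (hv : ∀ i, 0 ≤ v i) : TotallyNonneg (Matrix.of fun i j => v j * A i j) := by
  intro k r c hr hc
  have := Matrix.det_mul_row (v ∘ c) (A.submatrix r c)
  have h2 : (Matrix.of fun i j => v j * A i j).submatrix r c
    = Matrix.of fun i j => (v ∘ c) j * (A.submatrix r c) i j := rfl
  rw [h2, this]
  exact mul_nonneg (Finset.prod_nonneg fun i _ => hv _) (hA k r c hr hc)

open Polynomial in
lemma main_aux {n : ℕ} (A : Matrix (Fin n) (Fin n) ℝ) (hA : TotallyNonneg A) (hu : A.det ≠ 0) :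
    ∀ z, (Matrix.charpoly (A.map (algebraMap ℝ ℂ))).IsRoot z → ∃ r : ℝ, 0 < r ∧ z = r := by
  induction n with
  | zero => intro z hz; simp [Matrix.charpoly, IsRoot.def] at hz
  | succ n ih =>
    obtain ⟨κ, hκ, hgap⟩ := gap (n+1) (by simp)
    have hlead := hA.leading hu
    have hdet := hA.det_pos hu
    set A' := A.submatrix Fin.castSucc Fin.castSucc with hA'
    have hTN' : TotallyNonneg A' :=
      hA.submatrix _ _ (Fin.strictMono_castSucc) (Fin.strictMono_castSucc)
    let B : ℝ → Matrix (Fin (n+1)) (Fin (n+1)) ℝ := fun t =>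
      Matrix.of fun i j => (if j = Fin.last n then t else 1) * A i j
    have hq0 : ∀ (m : ℕ) (D : Matrix (Fin m) (Fin m) ℝ),
        (D.map (algebraMap ℝ ℂ)).charpoly.eval 0 = (((-1) ^ m * D.det : ℝ) : ℂ) := by
      intro m D
      have h := D.det_eq_sign_charpoly_coeff
      rw [Fintype.card_fin] at h
      rw [Matrix.charpoly_map, ← coeff_zero_eq_eval_zero, coeff_map, h, ← mul_assoc, ← mul_pow]
      simp
    refine poly_deform (A.map (algebraMap ℝ ℂ)).charpoly (A'.map (algebraMap ℝ ℂ)).charpoly (n+1)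
      κ hκ (fun t => ((B t).map (algebraMap ℝ ℂ)).charpoly) ?_ ?_ ?_ (ih A' hTN' hlead.ne')
      (A.det / A'.det) (div_pos hdet hlead) ?_ ?_
    · intro t
      have := charpoly_scale (A.map (algebraMap ℝ ℂ)) (t : ℂ)
      have e : (B t).map (algebraMap ℝ ℂ) = Matrix.of fun i j =>
          (if j = Fin.last n then (t : ℂ) else 1) * (A.map (algebraMap ℝ ℂ)) i j := by
        ext i j
        by_cases hj : j = Fin.last n <;> simp [B, hj]
      rw [e, this]
      push_cast
      rfl
    · intro t _ _
      exact ⟨Matrix.charpoly_monic _, by simp⟩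
    · intro t h0 _ z hz
      refine hgap (B t) (hA.scale _ fun i => ?_) ?_ z hz
      · split_ifs <;> linarith
      · have := Matrix.det_mul_row (fun j => if j = Fin.last n then t else 1) A
        simp only [B]
        rw [this]
        refine mul_ne_zero (Finset.prod_ne_zero_iff.2 fun i _ => ?_) hu
        split_ifs
        · exact h0.ne'
        · exact one_ne_zero
    · rw [hq0]
      exact_mod_cast mul_ne_zero (by simp) hlead.ne'
    · rw [hq0, hq0]
      have := hlead.ne'
      have e : ((-1) ^ (n + 1) * A.det : ℝ) = -(A.det / A'.det * ((-1) ^ n * A'.det)) := by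
        rw [pow_succ]
        field_simp
      rw [e, Complex.ofReal_neg, Complex.ofReal_mul]

/-- Every eigenvalue over `ℂ` (i.e. every root of the characteristic polynomial of the
complexified matrix) of an invertible totally nonnegative real matrix is a positive
real number. -/
theorem eigenvalues_of_invertible_totallyNonneg_pos {n : ℕ}
    (A : Matrix (Fin n) (Fin n) ℝ) (hA : TotallyNonneg A) (hAinv : IsUnit A)
    (μ : ℂ) (hμ : (Matrix.charpoly (A.map (algebraMap ℝ ℂ))).IsRoot μ) :
    ∃ r : ℝ, 0 < r ∧ μ = (r : ℂ) :=
  main_aux A hA ((Matrix.isUnit_iff_isUnit_det A).1 hAinv).ne_zero μ hμ
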